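/- Empty returns for stack: let h be a concurrent history over Σ_S and let h' be the subsequence of h obtained by deleting all events of method calls pop(e) with e ∈ Emp. If h is linearizable with respect to the pool specification S_P (reading push as ins and pop as rem) and h' is linearizable with respect to the stack specification S_S, then h is linearizable with respect to S_S. -/

import Mathlib

namespace LL

universe u v w

/-- Method calls of a container alphabet: insertions `ins x` of a value `x ∈ V`,
and removals `rem v` of a value `v ∈ V` or returning an "empty" value in `E`. -/
inductive CMethod (V : Type u) (E : Type v) where
  | ins : V → CMethod V E
  | rem : V ⊕ E → CMethod V E

/-- Events of a concurrent history: invocations and responses of method calls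
in `σ`, tagged with a thread identifier in `I`. -/
inductive Event (σ : Type u) (I : Type v) where
  | inv : σ → I → Event σ I
  | res : σ → I → Event σ I

variable {σ : Type*} {I : Type*} {V : Type*} {E : Type*} {α : Type*}

/-- The method call of an event. -/
def Event.method : Event σ I → σ
  | .inv m _ => m
  | .res m _ => m

/-- The thread identifier of an event. -/
def Event.thread : Event σ I → I
  | .inv _ k => k
  | .res _ k => k

/-- Whether an event is an invocation. -/
def Event.isInv : Event σ I → Bool
  | .inv _ _ => true
  | .res _ _ => false

/-- `a` occurs (strictly) before `b` in the sequence `s`. -/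
def OccursBefore (s : List α) (a b : α) : Prop :=
  ∃ i j : Fin s.length, i < j ∧ s.get i = a ∧ s.get j = b

/-- A set of sequences is prefix-closed. -/
def PrefixClosed (S : Set (List α)) : Prop :=
  ∀ s ∈ S, ∀ t : List α, t <+: s → t ∈ S

open Classical in
/-- The subsequence of events of thread `k`. -/
noncomputable def threadEvents (h : List (Event σ I)) (k : I) : List (Event σ I) :=
  h.filter fun e => decide (e.thread = k)

/-- `h` is a well-formed concurrent history: no event occurs twice, each method
call is invoked at most once, every response is preceded by its matching
invocation, and in every thread's subsequence of events each invocation is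
immediately followed by its matching response. -/
structure IsHistory (h : List (Event σ I)) : Prop where
  nodup : h.Nodup
  invUnique : ∀ (i j : Fin h.length) (m : σ) (k k' : I),
      h.get i = Event.inv m k → h.get j = Event.inv m k' → i = j
  resMatched : ∀ (j : Fin h.length) (m : σ) (k : I), h.get j = Event.res m k →
      ∃ i : Fin h.length, i < j ∧ h.get i = Event.inv m k
  threadSeq : ∀ (k : I) (i : ℕ) (m : σ),
      (threadEvents h k)[i]? = some (Event.inv m k) →
      ∀ e : Event σ I, (threadEvents h k)[i + 1]? = some e → e = Event.res m k

/-- The method call `m` appears in `h` (its invocation occurs in `h`). -/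
def Appears (h : List (Event σ I)) (m : σ) : Prop :=
  ∃ k : I, Event.inv m k ∈ h

/-- `h` is complete: every invocation has its matching response in `h`. -/
def HistComplete (h : List (Event σ I)) : Prop :=
  ∀ (m : σ) (k : I), Event.inv m k ∈ h → Event.res m k ∈ h

/-- The method call `m` (executed by thread `k`) is pending in `h`. -/
def PendingCall (h : List (Event σ I)) (m : σ) (k : I) : Prop :=
  Event.inv m k ∈ h ∧ Event.res m k ∉ h

/-- `hc` is a completion of `h`: a complete well-formed history obtained from `h`
by deleting some pending invocations and appending matching responses for the
remaining pending invocations. -/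
def IsCompletionOf (hc h : List (Event σ I)) : Prop :=
  IsHistory hc ∧ HistComplete hc ∧
  ∃ h' r : List (Event σ I),
    h'.Sublist h ∧
    (∀ e ∈ h, e ∉ h' → ∃ (m : σ) (k : I), e = Event.inv m k ∧ PendingCall h m k) ∧
    (∀ e ∈ r, ∃ (m : σ) (k : I), e = Event.res m k ∧ PendingCall h m k) ∧
    hc = h' ++ r

/-- The precedence order of `h`: `m <_h n` iff the response of `m` occurs in `h`
before the invocation of `n`. -/
def Precedes (h : List (Event σ I)) (m n : σ) : Prop :=
  ∃ (i j : Fin h.length) (k k' : I),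
    i < j ∧ h.get i = Event.res m k ∧ h.get j = Event.inv n k'

/-- The sequence of method calls of a history (in invocation order). -/
def methodList (h : List (Event σ I)) : List σ :=
  (h.filter Event.isInv).map Event.method

/-- `h` is linearizable wrt the sequential specification `S`. -/
def Linearizable (S : Set (List σ)) (h : List (Event σ I)) : Prop :=
  ∃ hc : List (Event σ I), IsCompletionOf hc h ∧
    ∃ s ∈ S, s.Perm (methodList hc) ∧
      ∀ m n : σ, Precedes hc m n → OccursBefore s m n

/-- `h` is sequentially consistent wrt `S`. -/
def SeqConsistent (S : Set (List σ)) (h : List (Event σ I)) : Prop :=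
  ∃ hc : List (Event σ I), IsCompletionOf hc h ∧
    ∃ s ∈ S, s.Perm (methodList hc) ∧
      ∀ m n : σ, Precedes hc m n →
        (∃ k : I, Event.inv m k ∈ hc ∧ Event.inv n k ∈ hc) →
        OccursBefore s m n

/-- Position `p` is a quiescent state of `h`: every invocation occurring before
position `p` has its matching response before position `p`. -/
def QuiescentAt (h : List (Event σ I)) (p : ℕ) : Prop :=
  ∀ (i : Fin h.length) (m : σ) (k : I), (i : ℕ) < p → h.get i = Event.inv m k →
    ∃ j : Fin h.length, (j : ℕ) < p ∧ h.get j = Event.res m k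

/-- `h` is quiescently consistent wrt `S`. -/
def QuiescentConsistent (S : Set (List σ)) (h : List (Event σ I)) : Prop :=
  ∃ hc : List (Event σ I), IsCompletionOf hc h ∧
    ∃ s ∈ S, s.Perm (methodList hc) ∧
      ∀ m n : σ,
        (∃ p : ℕ, QuiescentAt hc p ∧
          (∃ (i : Fin hc.length) (k : I), (i : ℕ) < p ∧ hc.get i = Event.res m k) ∧
          (∃ (j : Fin hc.length) (k : I), p ≤ (j : ℕ) ∧ hc.get j = Event.inv n k)) →
        OccursBefore s m n

/-- Membership of a method call in `I_T ∪ O_T`: insertions performed by thread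
`T` in `h`, removals of values inserted by `T` in `h`, and removals returning an
"empty" value. -/
def InducedMethod (h : List (Event (CMethod V E) I)) (T : I) : CMethod V E → Prop
  | .ins x => Event.inv (CMethod.ins x) T ∈ h
  | .rem (Sum.inl x) => Event.inv (CMethod.ins x) T ∈ h
  | .rem (Sum.inr _) => True

open Classical in
/-- The thread-induced history `h_T`: the subsequence of `h` of events of method
calls in `I_T ∪ O_T`. -/
noncomputable def threadInduced (h : List (Event (CMethod V E) I)) (T : I) :
    List (Event (CMethod V E) I) :=
  h.filter fun e => decide (InducedMethod h T e.method)

/-- `h` is locally linearizable wrt `S`: every thread-induced history is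
linearizable wrt `S`, and the thread-induced histories decompose `h`. -/
def LocallyLinearizable (S : Set (List (CMethod V E)))
    (h : List (Event (CMethod V E) I)) : Prop :=
  (∀ T : I, Linearizable S (threadInduced h T)) ∧
  (∀ m : CMethod V E, Appears h m → ∃ T : I, InducedMethod h T m)

/-- The pool sequential specification `S_P`. -/
def poolSpec (V : Type u) (E : Type v) : Set (List (CMethod V E)) :=
  { s | s.Nodup ∧
    (∀ x : V, CMethod.rem (Sum.inl x) ∈ s →
      CMethod.ins x ∈ s ∧
      OccursBefore s (CMethod.ins x) (CMethod.rem (Sum.inl x))) ∧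
    (∀ (e : E) (x : V),
      OccursBefore s (CMethod.ins x) (CMethod.rem (Sum.inr e)) →
      CMethod.rem (Sum.inl x) ∈ s ∧
      OccursBefore s (CMethod.rem (Sum.inl x)) (CMethod.rem (Sum.inr e))) }

/-- The queue sequential specification `S_Q` (pool axioms plus queue order). -/
def queueSpec (V : Type u) (E : Type v) : Set (List (CMethod V E)) :=
  { s | s ∈ poolSpec V E ∧
    ∀ x y : V, OccursBefore s (CMethod.ins x) (CMethod.ins y) →
      CMethod.rem (Sum.inl y) ∈ s →
      CMethod.rem (Sum.inl x) ∈ s ∧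
      OccursBefore s (CMethod.rem (Sum.inl x)) (CMethod.rem (Sum.inl y)) }

/-- The stack sequential specification `S_S` (pool axioms plus stack order). -/
def stackSpec (V : Type u) (E : Type v) : Set (List (CMethod V E)) :=
  { s | s ∈ poolSpec V E ∧
    ∀ x y : V, OccursBefore s (CMethod.ins x) (CMethod.ins y) →
      OccursBefore s (CMethod.ins y) (CMethod.rem (Sum.inl x)) →
      CMethod.rem (Sum.inl y) ∈ s ∧
      OccursBefore s (CMethod.rem (Sum.inl y)) (CMethod.rem (Sum.inl x)) }

/-- A method call's value lies in `V' ∪ Emp`. -/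
def ProjKeep (V' : Set V) : CMethod V E → Prop
  | .ins x => x ∈ V'
  | .rem (Sum.inl x) => x ∈ V'
  | .rem (Sum.inr _) => True

open Classical in
/-- The data-projection of a sequence: the subsequence of method calls whose
value lies in `V' ∪ Emp`. -/
noncomputable def dataProj (V' : Set V) (s : List (CMethod V E)) :
    List (CMethod V E) :=
  s.filter fun m => decide (ProjKeep V' m)

/-- `S` is closed under data-projection. -/
def ClosedUnderDataProjection (S : Set (List (CMethod V E))) : Prop :=
  ∀ s ∈ S, ∀ V' : Set V, dataProj V' s ∈ S

end LL

namespace LL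

/-- A removal returning an "empty" value. -/
def IsEmptyRem {V : Type*} {E : Type*} : CMethod V E → Prop
  | .rem (Sum.inr _) => True
  | _ => False

open Classical in
/-- The subsequence of `h` obtained by deleting all events of removals that
return an "empty" value. -/
noncomputable def delEmptyRem {V E I : Type*} (h : List (Event (CMethod V E) I)) :
    List (Event (CMethod V E) I) :=
  h.filter fun e => decide (¬ IsEmptyRem e.method)

theorem occursBefore_cons {α : Type*} {l : List α} {a b c : α} :
    OccursBefore (c :: l) a b ↔ (c = a ∧ b ∈ l) ∨ OccursBefore l a b := by
  constructor
  · rintro ⟨i, j, hij, ha, hb⟩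
    obtain ⟨j', rfl⟩ := Fin.exists_succ_eq.mpr (Fin.ne_zero_of_lt hij)
    rcases Fin.eq_zero_or_eq_succ i with rfl | ⟨i', rfl⟩
    · exact Or.inl ⟨by simpa using ha, by
        rw [← hb]; simp⟩
    · exact Or.inr ⟨i', j', by simpa using hij, by simpa using ha, by simpa using hb⟩
  · rintro (⟨rfl, hb⟩ | ⟨i, j, hij, ha, hb⟩)
    · obtain ⟨j, hj⟩ := List.get_of_mem hb
      exact ⟨0, j.succ, Fin.succ_pos j, by simp, by simpa using hj⟩
    · exact ⟨i.succ, j.succ, by simpa using hij, by simpa using ha, by simpa using hb⟩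

theorem occursBefore_iff_sublist {α : Type*} {l : List α} {a b : α} :
    OccursBefore l a b ↔ [a, b].Sublist l := by
  induction l with
  | nil => simp [OccursBefore]
  | cons c l ih =>
    rw [occursBefore_cons, ih, List.cons_sublist_cons']
    simp only [List.singleton_sublist]
    grind

namespace OccursBefore

variable {α : Type*} {l l₁ l₂ : List α} {a b : α}

theorem mem_left (h : OccursBefore l a b) : a ∈ l := by
  obtain ⟨i, -, -, rfl, -⟩ := h
  exact l.get_mem i

theorem mem_right (h : OccursBefore l a b) : b ∈ l := by
  obtain ⟨-, j, -, -, rfl⟩ := h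
  exact l.get_mem j

theorem mono (h : OccursBefore l₁ a b) (hl : l₁.Sublist l₂) : OccursBefore l₂ a b :=
  occursBefore_iff_sublist.mpr ((occursBefore_iff_sublist.mp h).trans hl)

end OccursBefore

section

variable {α : Type*} {l l₁ l₂ : List α} {a b c : α}

theorem occursBefore_append :
    OccursBefore (l₁ ++ l₂) a b ↔
      OccursBefore l₁ a b ∨ OccursBefore l₂ a b ∨ (a ∈ l₁ ∧ b ∈ l₂) := by
  induction l₁ with
  | nil => simp [OccursBefore]
  | cons c l ih =>
    simp only [List.cons_append, occursBefore_cons, ih, List.mem_append, List.mem_cons]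
    grind

theorem mem_filter_decide {p : α → Prop} [DecidablePred p] :
    a ∈ l.filter (fun x => decide (p x)) ↔ a ∈ l ∧ p a := by
  rw [List.mem_filter, decide_eq_true_eq]

theorem occursBefore_filter {p : α → Prop} [DecidablePred p] :
    OccursBefore (l.filter fun x => decide (p x)) a b ↔ OccursBefore l a b ∧ p a ∧ p b := by
  constructor
  · intro h
    exact ⟨h.mono List.filter_sublist, (mem_filter_decide.mp h.mem_left).2,
      (mem_filter_decide.mp h.mem_right).2⟩
  · rintro ⟨h, ha, hb⟩
    have := (occursBefore_iff_sublist.mp h).filter fun x => decide (p x)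
    rw [occursBefore_iff_sublist]
    simpa [ha, hb] using this

theorem occursBefore_singleton : ¬ OccursBefore [c] a b := by
  rw [occursBefore_cons]
  simp [OccursBefore]

open Classical in
theorem occursBefore_iff_idxOf (hl : l.Nodup) :
    OccursBefore l a b ↔ l.idxOf a < l.idxOf b ∧ b ∈ l := by
  constructor
  · rintro ⟨i, j, hij, rfl, rfl⟩
    refine ⟨?_, l.get_mem j⟩
    simpa [hl.idxOf_getElem] using hij
  · rintro ⟨hab, hb⟩
    have hb' := List.idxOf_lt_length_iff.mpr hb
    exact ⟨⟨_, hab.trans hb'⟩, ⟨_, hb'⟩, hab, by simp, by simp⟩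

theorem OccursBefore.trans (hl : l.Nodup) (h₁ : OccursBefore l a b)
    (h₂ : OccursBefore l b c) : OccursBefore l a c := by
  rw [occursBefore_iff_idxOf hl] at *
  exact ⟨h₁.1.trans h₂.1, h₂.2⟩

theorem OccursBefore.asymm (hl : l.Nodup) (h₁ : OccursBefore l a b) :
    ¬ OccursBefore l b a := by
  rw [occursBefore_iff_idxOf hl] at *
  exact fun h₂ => lt_asymm h₁.1 h₂.1

open Classical in
theorem OccursBefore.restrict (hl : l₂.Nodup) (hs : l₁.Sublist l₂)
    (h : OccursBefore l₂ a b) (ha : a ∈ l₁) (hb : b ∈ l₁) : OccursBefore l₁ a b := by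
  have hl₁ := hl.sublist hs
  rw [occursBefore_iff_idxOf hl₁]
  refine ⟨?_, hb⟩
  by_contra hlt
  rcases (not_lt.mp hlt).eq_or_lt with he | hlt
  · obtain rfl := (List.idxOf_inj hb).mp he
    exact h.asymm hl h
  · exact h.asymm hl (((occursBefore_iff_idxOf hl₁).mpr ⟨hlt, ha⟩).mono hs)

end

section History

variable {σ I : Type*} {h : List (Event σ I)}

theorem precedes_iff {m n : σ} :
    Precedes h m n ↔ ∃ k k', OccursBefore h (Event.res m k) (Event.inv n k') := by
  constructor
  · rintro ⟨i, j, k, k', hij, hi, hj⟩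
    exact ⟨k, k', i, j, hij, hi, hj⟩
  · rintro ⟨k, k', i, j, hij, hi, hj⟩
    exact ⟨i, j, k, k', hij, hi, hj⟩

theorem mem_methodList {m : σ} : m ∈ methodList h ↔ ∃ k, Event.inv m k ∈ h := by
  simp only [methodList, List.mem_map, List.mem_filter]
  constructor
  · rintro ⟨⟨m', k⟩ | ⟨m', k⟩, ⟨hm, hi⟩, rfl⟩
    · exact ⟨k, hm⟩
    · simp [Event.isInv] at hi
  · rintro ⟨k, hk⟩
    exact ⟨_, ⟨hk, rfl⟩, rfl⟩

/-- Every invocation of thread `k` is immediately followed by its matching response. -/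
def Follows (k : I) (a b : Event σ I) : Prop :=
  ∀ m, a = Event.inv m k → b = Event.res m k

theorem threadSeq_iff_isChain {k : I} {l : List (Event σ I)} :
    (∀ (i : ℕ) (m : σ), l[i]? = some (Event.inv m k) →
      ∀ e : Event σ I, l[i + 1]? = some e → e = Event.res m k) ↔
    l.IsChain (Follows k) := by
  rw [List.isChain_iff_getElem]
  constructor
  · intro H i hi m hm
    exact H i m (by rw [← hm]; simp) _ (by simp)
  · intro H i m hm e he
    obtain ⟨hi, hm⟩ := List.getElem?_eq_some_iff.mp hm
    obtain ⟨hi', rfl⟩ := List.getElem?_eq_some_iff.mp he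
    exact H i hi' m hm

namespace IsHistory

theorem thread_unique (hh : IsHistory h) {m : σ} {k k' : I}
    (hk : Event.inv m k ∈ h) (hk' : Event.inv m k' ∈ h) : k = k' := by
  obtain ⟨i, hi⟩ := List.get_of_mem hk
  obtain ⟨j, hj⟩ := List.get_of_mem hk'
  obtain rfl := hh.invUnique i j m k k' hi hj
  rw [hi] at hj
  exact (Event.inv.inj hj).2

theorem inv_before_res (hh : IsHistory h) {m : σ} {k : I} (hk : Event.res m k ∈ h) :
    OccursBefore h (Event.inv m k) (Event.res m k) := by
  obtain ⟨j, hj⟩ := List.get_of_mem hk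
  obtain ⟨i, hij, hi⟩ := hh.resMatched j m k hj
  exact ⟨i, j, hij, hi, hj⟩

theorem isChain (hh : IsHistory h) (k : I) : (threadEvents h k).IsChain (Follows k) :=
  threadSeq_iff_isChain.mp (hh.threadSeq k)

theorem of_occursBefore (hnd : h.Nodup)
    (hu : ∀ m k k', Event.inv m k ∈ h → Event.inv m k' ∈ h → k = k')
    (hm : ∀ m k, Event.res m k ∈ h → OccursBefore h (Event.inv m k) (Event.res m k))
    (hch : ∀ k, (threadEvents h k).IsChain (Follows k)) : IsHistory h where
  nodup := hnd
  invUnique i j m k k' hi hj := by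
    have := hu m k k' (hi ▸ h.get_mem i) (hj ▸ h.get_mem j)
    subst this
    exact hnd.injective_get (hi.trans hj.symm)
  resMatched j m k hj := by
    obtain ⟨i, j', hij, hi, hj'⟩ := hm m k (hj ▸ h.get_mem j)
    obtain rfl := hnd.injective_get (hj'.trans hj.symm)
    exact ⟨i, hij, hi⟩
  threadSeq k := threadSeq_iff_isChain.mpr (hch k)

end IsHistory

theorem isChain_filter_of_dead {α : Type*} {R : α → α → Prop} {p : α → Bool} {l : List α}
    (hl : l.IsChain R) (hp : ∀ a ∈ l, p a = false → ∀ b ∈ l, ¬ R a b) :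
    (l.filter p).IsChain R := by
  induction l with
  | nil => simp
  | cons a l ih =>
    have ih := ih hl.tail fun a ha h b hb => hp a (by simp [ha]) h b (by simp [hb])
    cases l with
    | nil => by_cases h : p a <;> simp [h]
    | cons b l =>
      rw [List.isChain_cons_cons] at hl
      have ha : p a = true := by
        by_contra h
        exact hp a (by simp) (by simpa using h) b (by simp) hl.1
      by_cases hb : p b = true
      · simp only [List.filter_cons, ha, hb, if_true] at ih ⊢
        exact List.isChain_cons_cons.mpr ⟨hl.1, ih⟩
      · cases l with
        | nil => simp [ha, hb]
        | cons c l =>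
          exact absurd (List.isChain_cons_cons.mp hl.2).1
            (hp b (by simp) (by simpa using hb) c (by simp))

theorem getLast?_of_dead {α : Type*} {R : α → α → Prop} {a : α} {l : List α}
    (hl : l.IsChain R) (ha : a ∈ l) (hd : ∀ b ∈ l, ¬ R a b) : l.getLast? = some a := by
  induction l with
  | nil => simp at ha
  | cons c l ih =>
    cases l with
    | nil => simpa using (List.mem_singleton.mp ha).symm
    | cons b l =>
      rw [List.isChain_cons_cons] at hl
      rcases List.mem_cons.mp ha with rfl | ha
      · exact absurd hl.1 (hd b (by simp))
      · rw [List.getLast?_cons_cons]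
        exact ih hl.2 ha fun b hb => hd b (by simp [hb])

theorem linearizable_elim {S : Set (List σ)} (hnd : h.Nodup)
    (hu : ∀ m k k', Event.inv m k ∈ h → Event.inv m k' ∈ h → k = k')
    (H : Linearizable S h) :
    ∃ s ∈ S, (∀ m ∈ s, ∃ k, Event.inv m k ∈ h) ∧ (∀ m k, Event.res m k ∈ h → m ∈ s) ∧
      ∀ m n, Precedes h m n → n ∈ s → OccursBefore s m n := by
  obtain ⟨hc, ⟨hhc, -, h', r, hsub, hdel, hr, rfl⟩, s, hs, hperm, hprec⟩ := H
  have mem_s : ∀ m, m ∈ s ↔ ∃ k, Event.inv m k ∈ h' := by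
    intro m
    rw [hperm.mem_iff, mem_methodList]
    refine exists_congr fun k => ⟨fun hk => ?_, fun hk => by simp [hk]⟩
    rcases List.mem_append.mp hk with hk | hk
    · exact hk
    · obtain ⟨_, _, he, -⟩ := hr _ hk
      cases he
  have res_mem : ∀ m k, Event.res m k ∈ h → Event.res m k ∈ h' := by
    intro m k hk
    by_contra hn
    obtain ⟨_, _, he, -⟩ := hdel _ hk hn
    cases he
  refine ⟨s, hs, fun m hm => ?_, fun m k hk => ?_, fun m n hmn hn => ?_⟩
  · obtain ⟨k, hk⟩ := (mem_s m).mp hm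
    exact ⟨k, hsub.subset hk⟩
  · rw [hperm.mem_iff, mem_methodList]
    exact ⟨k, (hhc.inv_before_res (List.mem_append_left r (res_mem m k hk))).mem_left⟩
  · obtain ⟨k, k', hb⟩ := precedes_iff.mp hmn
    obtain ⟨k'', hk''⟩ := (mem_s n).mp hn
    obtain rfl := hu n k' k'' hb.mem_right (hsub.subset hk'')
    refine hprec m n (precedes_iff.mpr ⟨k, k', ?_⟩)
    exact (hb.restrict hnd hsub (res_mem m k hb.mem_left) hk'').mono (List.sublist_append_left h' r)

open Classical in
/-- The responses of the pending calls of `h` that occur in `s`. -/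
noncomputable def pendingResponses (h : List (Event σ I)) (s : List σ) : List (Event σ I) :=
  h.filterMap fun
    | .inv m k => if m ∈ s ∧ Event.res m k ∉ h then some (Event.res m k) else none
    | .res _ _ => none

theorem mem_pendingResponses {s : List σ} {e : Event σ I} :
    e ∈ pendingResponses h s ↔
      ∃ m k, e = Event.res m k ∧ m ∈ s ∧ PendingCall h m k := by
  simp only [pendingResponses, List.mem_filterMap]
  constructor
  · rintro ⟨⟨m, k⟩ | ⟨m, k⟩, hm, he⟩
    · simp only [Option.ite_none_right_eq_some, Option.some.injEq] at he
      exact ⟨m, k, he.2.symm, he.1.1, hm, he.1.2⟩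
    · simp at he
  · rintro ⟨m, k, rfl, hs, hm, hr⟩
    exact ⟨_, hm, by simp [hs, hr]⟩

theorem nodup_pendingResponses {s : List σ} (hnd : h.Nodup) : (pendingResponses h s).Nodup := by
  refine hnd.filterMap ?_
  rintro (⟨m, k⟩ | ⟨m, k⟩) (⟨m', k'⟩ | ⟨m', k'⟩) e he he' <;> simp_all
  obtain ⟨⟨-, -⟩, h1⟩ := he
  have := h1.trans he'.2.symm
  cases this
  exact ⟨rfl, rfl⟩

open Classical in
theorem linearizable_intro {S : Set (List σ)} (hh : IsHistory h) {s : List σ} (hs : s ∈ S)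
    (hnd : s.Nodup) (hinv : ∀ m ∈ s, ∃ k, Event.inv m k ∈ h)
    (hres : ∀ m k, Event.res m k ∈ h → m ∈ s)
    (hprec : ∀ m n, Precedes h m n → m ∈ s → n ∈ s → OccursBefore s m n) :
    Linearizable S h := by
  set f : List (Event σ I) := h.filter fun e => decide (e.method ∈ s) with hf
  set r := pendingResponses h s with hr
  have inv_f : ∀ m k, Event.inv m k ∈ f ↔ Event.inv m k ∈ h ∧ m ∈ s := by
    intro m k
    rw [hf, mem_filter_decide]
    rfl
  have res_f : ∀ m k, Event.res m k ∈ f ↔ Event.res m k ∈ h := by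
    intro m k
    rw [hf, mem_filter_decide]
    exact ⟨And.left, fun hk => ⟨hk, hres m k hk⟩⟩
  have inv_r : ∀ m k, Event.inv m k ∉ r := by
    intro m k hk
    obtain ⟨_, _, he, -⟩ := mem_pendingResponses.mp hk
    cases he
  have res_r : ∀ m k, Event.res m k ∈ r ↔ m ∈ s ∧ PendingCall h m k := by
    intro m k
    rw [hr, mem_pendingResponses]
    constructor
    · rintro ⟨m', k', he, hp⟩
      cases he
      exact hp
    · exact fun hp => ⟨m, k, rfl, hp⟩
  have inv_hc : ∀ m k, Event.inv m k ∈ f ++ r ↔ Event.inv m k ∈ h ∧ m ∈ s := by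
    intro m k; simp [inv_f, inv_r]
  have hndhc : (f ++ r).Nodup := by
    refine List.nodup_append'.mpr ⟨hh.nodup.filter _, nodup_pendingResponses hh.nodup, ?_⟩
    rintro (⟨m, k⟩ | ⟨m, k⟩) h₁ h₂
    · exact inv_r m k h₂
    · exact ((res_r m k).mp h₂).2.2 ((res_f m k).mp h₁)
  have hu : ∀ m k k', Event.inv m k ∈ f ++ r → Event.inv m k' ∈ f ++ r → k = k' :=
    fun m k k' hk hk' => hh.thread_unique ((inv_hc m k).mp hk).1 ((inv_hc m k').mp hk').1
  have hist : IsHistory (f ++ r) := by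
    refine IsHistory.of_occursBefore hndhc hu (fun m k hk => ?_) fun k => ?_
    · rw [occursBefore_append]
      rcases List.mem_append.mp hk with hk | hk
      · left
        have hk' := (res_f m k).mp hk
        rw [hf, occursBefore_filter]
        exact ⟨hh.inv_before_res hk', hres m k hk', hres m k hk'⟩
      · have hk' := (res_r m k).mp hk
        exact Or.inr (Or.inr ⟨(inv_f m k).mpr ⟨hk'.2.1, hk'.1⟩, hk⟩)
    · have hdead : ∀ m k, Event.res m k ∉ h → ∀ b ∈ h, ¬ Follows k (Event.inv m k) b :=
        fun m k hk b hb hR => hk (hR m rfl ▸ hb)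
      have hchain : (threadEvents f k).IsChain (Follows k) := by
        rw [hf, threadEvents, List.filter_comm]
        refine isChain_filter_of_dead (hh.isChain k) ?_
        intro a ha hpa b hb
        obtain ⟨ha, hak⟩ := mem_filter_decide.mp ha
        have hbh := (mem_filter_decide.mp hb).1
        have hpa := of_decide_eq_false hpa
        rcases a with ⟨m, k'⟩ | ⟨m, k'⟩
        · obtain rfl : k' = k := hak
          exact hdead m k' (fun hk => hpa (hres m k' hk)) b hbh
        · exact absurd (hres m k' ha) hpa
      have split : threadEvents (f ++ r) k = threadEvents f k ++ threadEvents r k := by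
        simp [threadEvents]
      rw [split, List.isChain_append]
      refine ⟨hchain, ?_, ?_⟩
      · refine List.Pairwise.isChain (List.pairwise_of_forall_mem_list ?_)
        rintro a ha b - m rfl
        exact absurd (List.mem_filter.mp ha).1 (inv_r m k)
      · rintro a ha b hb m rfl
        obtain ⟨hbr, hbk⟩ := mem_filter_decide.mp (List.mem_of_mem_head? hb)
        rcases b with ⟨m', k'⟩ | ⟨m', k'⟩
        · exact absurd hbr (inv_r m' k')
        · obtain rfl : k' = k := hbk
          obtain ⟨hm', hp⟩ := (res_r m' k').mp hbr
          have hlast := getLast?_of_dead hchain (a := Event.inv m' k')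
            (mem_filter_decide.mpr ⟨(inv_f m' k').mpr ⟨hp.1, hm'⟩, rfl⟩)
            fun b hb => hdead m' k' hp.2 b
              (List.filter_sublist.subset (List.mem_filter.mp hb).1)
          rw [hlast] at ha
          cases ha
          rfl
  refine ⟨f ++ r, ⟨hist, ?_, f, r, List.filter_sublist, ?_, ?_, rfl⟩, s, hs, ?_, ?_⟩
  · intro m k hk
    have hk := (inv_hc m k).mp hk
    rw [List.mem_append, res_f, res_r]
    by_cases hmk : Event.res m k ∈ h
    · exact Or.inl hmk
    · exact Or.inr ⟨hk.2, hk.1, hmk⟩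
  · rintro (⟨m, k⟩ | ⟨m, k⟩) he hn
    · exact ⟨m, k, rfl, he, fun hk => hn ((inv_f m k).mpr ⟨he, hres m k hk⟩)⟩
    · exact absurd ((res_f m k).mpr he) hn
  · intro e he
    obtain ⟨m, k, rfl, -, hp⟩ := mem_pendingResponses.mp he
    exact ⟨m, k, rfl, hp⟩
  · have hml : (methodList (f ++ r)).Nodup := by
      refine List.Nodup.map_on ?_ (hndhc.filter _)
      intro a ha b hb hab
      obtain ⟨ha, hai⟩ := List.mem_filter.mp ha
      obtain ⟨hb, hbi⟩ := List.mem_filter.mp hb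
      rcases a with ⟨m, k⟩ | ⟨m, k⟩ <;> rcases b with ⟨m', k'⟩ | ⟨m', k'⟩ <;>
        simp only [Event.isInv, Bool.false_eq_true] at hai hbi
      obtain rfl : m = m' := hab
      rw [hu m k k' ha hb]
    refine (List.perm_ext_iff_of_nodup hnd hml).mpr fun m => ?_
    rw [mem_methodList]
    constructor
    · intro hm
      obtain ⟨k, hk⟩ := hinv m hm
      exact ⟨k, (inv_hc m k).mpr ⟨hk, hm⟩⟩
    · rintro ⟨k, hk⟩
      exact ((inv_hc m k).mp hk).2
  · intro m n hmn
    obtain ⟨k, k', hb⟩ := precedes_iff.mp hmn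
    rw [occursBefore_append] at hb
    rcases hb with hb | hb | ⟨-, hb⟩
    · rw [hf, occursBefore_filter] at hb
      exact hprec m n (precedes_iff.mpr ⟨k, k', hb.1⟩) hb.2.1 hb.2.2
    · exact absurd hb.mem_right (inv_r n k')
    · exact absurd hb (inv_r n k')

end History

section Stack

variable {V E : Type*}

open Classical in
/-- Removals of the values that `s` inserts by a call in `A` and never removes, the most
recently inserted value first. -/
noncomputable def closingRems (A : CMethod V E → Prop) (s : List (CMethod V E)) :
    List (CMethod V E) :=
  (s.filterMap fun
    | .ins x => if A (.ins x) ∧ CMethod.rem (Sum.inl x) ∉ s then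
        some (CMethod.rem (Sum.inl x)) else none
    | .rem _ => none).reverse

variable {A : CMethod V E → Prop} {s : List (CMethod V E)}

theorem mem_closingRems {m : CMethod V E} :
    m ∈ closingRems A s ↔ ∃ x, m = .rem (Sum.inl x) ∧
      CMethod.ins x ∈ s ∧ A (.ins x) ∧ CMethod.rem (Sum.inl x) ∉ s := by
  simp only [closingRems, List.mem_reverse, List.mem_filterMap]
  constructor
  · rintro ⟨x | v, hm, he⟩
    · simp only [Option.ite_none_right_eq_some, Option.some.injEq] at he
      exact ⟨x, he.2.symm, hm, he.1⟩
    · simp at he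
  · rintro ⟨x, rfl, hm, hA, hr⟩
    exact ⟨_, hm, by simp [hA, hr]⟩

theorem rem_mem_closingRems {x : V} :
    CMethod.rem (Sum.inl x) ∈ closingRems A s ↔
      CMethod.ins x ∈ s ∧ A (.ins x) ∧ CMethod.rem (Sum.inl x) ∉ s := by
  rw [mem_closingRems]
  constructor
  · rintro ⟨y, he, hy⟩
    cases he
    exact hy
  · exact fun hx => ⟨x, rfl, hx⟩

theorem nodup_closingRems (hnd : s.Nodup) : (closingRems A s).Nodup := by
  refine List.nodup_reverse.mpr (hnd.filterMap ?_)
  rintro (x | v) (x' | v') e he he' <;> simp_all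
  have := he.2.trans he'.2.symm
  cases this
  rfl

open Classical in
theorem occursBefore_closingRems {x y : V} (hxy : OccursBefore s (.ins x) (.ins y))
    (hx : CMethod.rem (Sum.inl x) ∈ closingRems A s)
    (hy : CMethod.rem (Sum.inl y) ∈ closingRems A s) :
    OccursBefore (closingRems A s) (.rem (Sum.inl y)) (.rem (Sum.inl x)) := by
  rw [rem_mem_closingRems] at hx hy
  have := (occursBefore_iff_sublist.mp hxy).filterMap (fun
    | CMethod.ins x => if A (.ins x) ∧ CMethod.rem (Sum.inl x) ∉ s then
        some (CMethod.rem (E := E) (Sum.inl x)) else none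
    | .rem _ => none)
  rw [occursBefore_iff_sublist, closingRems, ← List.reverse_sublist, List.reverse_reverse]
  simpa [hx.2, hy.2] using this

open Classical in
/-- The calls of `s` in `A`, closed by removals of the remaining values, followed by `r` and
the other calls of `s`. -/
noncomputable def insertEmpty (A : CMethod V E → Prop) (r : CMethod V E)
    (s : List (CMethod V E)) : List (CMethod V E) :=
  s.filter (fun m => decide (A m)) ++
    (closingRems A s ++ ([r] ++ s.filter (fun m => decide (¬ A m))))

theorem mem_insertEmpty {r m : CMethod V E} :
    m ∈ insertEmpty A r s ↔ m ∈ s ∨ m ∈ closingRems A s ∨ m = r := by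
  simp only [insertEmpty, List.mem_append, List.mem_filter, decide_eq_true_eq, List.mem_singleton]
  tauto

theorem occursBefore_insertEmpty {r a b : CMethod V E} :
    OccursBefore (insertEmpty A r s) a b ↔
      (OccursBefore s a b ∧ (A a ↔ A b)) ∨ (a ∈ s ∧ A a ∧ b ∈ s ∧ ¬ A b) ∨
      (a ∈ s ∧ A a ∧ (b ∈ closingRems A s ∨ b = r)) ∨
      OccursBefore (closingRems A s) a b ∨ (a ∈ closingRems A s ∧ b = r) ∨
      ((a ∈ closingRems A s ∨ a = r) ∧ b ∈ s ∧ ¬ A b) := by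
  simp only [insertEmpty, occursBefore_append, occursBefore_filter, occursBefore_singleton,
    List.mem_append, List.mem_filter, decide_eq_true_eq, List.mem_singleton]
  tauto

open Classical in
theorem insertEmpty_mem_stackSpec {e : E} (hs : s ∈ stackSpec V E)
    (hA : ∀ x, A (.ins x) ↔ A (.rem (Sum.inl x)))
    (he : CMethod.rem (Sum.inr e) ∉ s) :
    insertEmpty A (.rem (Sum.inr e)) s ∈ stackSpec V E := by
  obtain ⟨⟨hnd, hrem, hemp⟩, hst⟩ := hs
  have ins_closing : ∀ x : V, CMethod.ins x ∉ closingRems A s := by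
    intro x hx
    obtain ⟨_, h, -⟩ := mem_closingRems.mp hx
    cases h
  have emp_closing : ∀ e' : E, CMethod.rem (Sum.inr e') ∉ closingRems A s := by
    intro x hx
    obtain ⟨_, h, -⟩ := mem_closingRems.mp hx
    cases h
  have closing_disj : ∀ m ∈ closingRems A s, m ∉ s := by
    intro m hm
    obtain ⟨x, rfl, -, -, h⟩ := mem_closingRems.mp hm
    exact h
  have with_mem : ∀ {a b : CMethod V E}, OccursBefore (insertEmpty A (.rem (Sum.inr e)) s) a b →
      a ∈ insertEmpty A (.rem (Sum.inr e)) s ∧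
        OccursBefore (insertEmpty A (.rem (Sum.inr e)) s) a b :=
    fun h => ⟨h.mem_left, h⟩
  refine ⟨⟨?_, fun x hx => with_mem ?_, fun e' x hx => with_mem ?_⟩,
    fun x y hxy hyx => with_mem ?_⟩
  · have := hnd.filter (fun m => decide (A m))
    have := hnd.filter (fun m => decide (¬ A m))
    have := nodup_closingRems (A := A) hnd
    simp only [insertEmpty, List.nodup_append', List.disjoint_left]
    grind
  · rw [mem_insertEmpty] at hx
    rw [occursBefore_insertEmpty]
    rcases hx with hx | hx | hx
    · exact Or.inl ⟨(hrem x hx).2, hA x⟩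
    · have := rem_mem_closingRems.mp hx
      tauto
    · cases hx
  · rw [occursBefore_insertEmpty] at hx ⊢
    have hcl := @rem_mem_closingRems V E A s x
    have h1 := ins_closing x
    have h2 := emp_closing e'
    have h3 := hemp e' x
    have h4 := hA x
    have h5 : ¬ OccursBefore (closingRems A s) (.ins x) (.rem (Sum.inr e')) :=
      fun h => h1 h.mem_left
    have h6 : OccursBefore s (.ins x) (.rem (Sum.inr e')) →
      CMethod.ins x ∈ s ∧ CMethod.rem (Sum.inr e') ∈ s := fun h => ⟨h.mem_left, h.mem_right⟩
    grind
  · rw [occursBefore_insertEmpty] at hxy hyx ⊢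
    have hclx := @rem_mem_closingRems V E A s x
    have hcly := @rem_mem_closingRems V E A s y
    have h1 := ins_closing x
    have h2 := ins_closing y
    have h3 := hst x y
    have h4 := hA x
    have h5 := hA y
    have h6 : ¬ OccursBefore (closingRems A s) (.ins x) (.ins y) := fun h => h1 h.mem_left
    have h7 : ¬ OccursBefore (closingRems A s) (.ins y) (.rem (Sum.inl x)) :=
      fun h => h2 h.mem_left
    have h8 := @occursBefore_closingRems V E A s x y
    have h9 : OccursBefore s (.ins x) (.ins y) →
      CMethod.ins x ∈ s ∧ CMethod.ins y ∈ s := fun h => ⟨h.mem_left, h.mem_right⟩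
    grind

end Stack

section EmptyReturns

variable {V E I : Type*}

open Classical in
theorem mem_delEmptyRem {h : List (Event (CMethod V E) I)} {a : Event (CMethod V E) I} :
    a ∈ delEmptyRem h ↔ a ∈ h ∧ ¬ IsEmptyRem a.method :=
  mem_filter_decide

open Classical in
theorem occursBefore_delEmptyRem {h : List (Event (CMethod V E) I)}
    {a b : Event (CMethod V E) I} :
    OccursBefore (delEmptyRem h) a b ↔
      OccursBefore h a b ∧ ¬ IsEmptyRem a.method ∧ ¬ IsEmptyRem b.method :=
  occursBefore_filter

/-- `s` is a stack linearization of some completion of `h` from which some removals returning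
an empty value are left out. -/
structure IsPartialLinearization (h : List (Event (CMethod V E) I)) (s : List (CMethod V E)) :
    Prop where
  mem_stackSpec : s ∈ stackSpec V E
  invoked : ∀ m ∈ s, ∃ k, Event.inv m k ∈ h
  completed : ∀ m k, Event.res m k ∈ h → ¬ IsEmptyRem m → m ∈ s
  precedes : ∀ m n, Precedes h m n → m ∈ s → n ∈ s → OccursBefore s m n

theorem IsPartialLinearization.exists_insert {h : List (Event (CMethod V E) I)}
    {s p : List (CMethod V E)} (hs : IsPartialLinearization h s) (hp : p ∈ poolSpec V E)
    (hinv : ∀ m ∈ p, ∃ k, Event.inv m k ∈ h)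
    (hprec : ∀ m n, Precedes h m n → n ∈ p → OccursBefore p m n)
    {e : E} (he : CMethod.rem (Sum.inr e) ∈ p) :
    ∃ s', IsPartialLinearization h s' ∧ CMethod.rem (Sum.inr e) ∈ s' ∧ s ⊆ s' := by
  by_cases hes : CMethod.rem (Sum.inr e) ∈ s
  · exact ⟨s, hs, hes, List.Subset.refl s⟩
  obtain ⟨hnd, hrem, hemp⟩ := hp
  set r : CMethod V E := .rem (Sum.inr e) with hr
  set A : CMethod V E → Prop := fun m => OccursBefore p m r with hAdef
  have hA : ∀ x, A (.ins x) ↔ A (.rem (Sum.inl x)) := fun x =>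
    ⟨fun h => (hemp e x h).2, fun h => (hrem x h.mem_left).2.trans hnd h⟩
  have hAr : ¬ A r := fun h => h.asymm hnd h
  refine ⟨insertEmpty A r s, ⟨insertEmpty_mem_stackSpec hs.mem_stackSpec hA hes, ?_, ?_, ?_⟩,
    by simp [mem_insertEmpty], fun m hm => mem_insertEmpty.mpr (Or.inl hm)⟩
  · intro m hm
    rcases mem_insertEmpty.mp hm with hm | hm | rfl
    · exact hs.invoked m hm
    · obtain ⟨x, rfl, -, hx, -⟩ := mem_closingRems.mp hm
      exact hinv _ ((hA x).mp hx).mem_left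
    · exact hinv _ he
  · exact fun m k hk hm => mem_insertEmpty.mpr (Or.inl (hs.completed m k hk hm))
  · intro m n hmn hm hn
    obtain ⟨k, k', hb⟩ := precedes_iff.mp hmn
    have hmc : m ∉ closingRems A s := by
      intro hmc
      obtain ⟨x, rfl, -, -, hx⟩ := mem_closingRems.mp hmc
      exact hx (hs.completed _ k hb.mem_left (by simp [IsEmptyRem]))
    have hA_left : n = r ∨ A n → A m := by
      rintro (rfl | hn)
      · exact hprec m _ hmn he
      · exact (hprec m n hmn hn.mem_left).trans hnd hn
    have hnc : n ∈ closingRems A s → A n := by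
      intro hnc
      obtain ⟨x, rfl, -, hx, -⟩ := mem_closingRems.mp hnc
      exact (hA x).mp hx
    have := hs.precedes m n hmn
    rw [mem_insertEmpty] at hm hn
    rw [occursBefore_insertEmpty]
    clear_value A r
    grind

end EmptyReturns

/-- Empty returns for stack: if `h` is linearizable wrt the pool specification
and `h` without the empty-returning pops is linearizable wrt the stack
specification, then `h` is linearizable wrt the stack specification. -/
theorem stack_empty_returns
    (V E I : Type*) (h : List (Event (CMethod V E) I)) (hh : IsHistory h)
    (hpool : Linearizable (poolSpec V E) h)
    (hstack : Linearizable (stackSpec V E) (delEmptyRem h)) :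
    Linearizable (stackSpec V E) h := by
  obtain ⟨p, hp, pinv, pres, pprec⟩ :=
    linearizable_elim hh.nodup (fun _ _ _ => hh.thread_unique) hpool
  have hsub : (delEmptyRem h).Sublist h := List.filter_sublist
  obtain ⟨s₀, hs₀, sinv, sres, sprec⟩ := linearizable_elim (hh.nodup.sublist hsub)
    (fun _ _ _ hk hk' => hh.thread_unique (hsub.subset hk) (hsub.subset hk')) hstack
  have hne : ∀ m ∈ s₀, ¬ IsEmptyRem m := by
    intro m hm
    obtain ⟨k, hk⟩ := sinv m hm
    exact (mem_delEmptyRem.mp hk).2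
  have hpart : IsPartialLinearization h s₀ := by
    refine ⟨hs₀, fun m hm => ?_, fun m k hk hm => ?_, fun m n hmn hm hn => ?_⟩
    · obtain ⟨k, hk⟩ := sinv m hm
      exact ⟨k, hsub.subset hk⟩
    · exact sres m k (mem_delEmptyRem.mpr ⟨hk, hm⟩)
    · obtain ⟨k, k', hb⟩ := precedes_iff.mp hmn
      refine sprec m n (precedes_iff.mpr ⟨k, k', ?_⟩) hn
      rw [occursBefore_delEmptyRem]
      exact ⟨hb, hne m hm, hne n hn⟩
  have hall : ∀ l : List (CMethod V E), l ⊆ p → ∃ s, IsPartialLinearization h s ∧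
      ∀ m ∈ l, IsEmptyRem m → m ∈ s := by
    intro l
    induction l with
    | nil => exact fun _ => ⟨s₀, hpart, by simp⟩
    | cons m l ih =>
      intro hl
      obtain ⟨s, hs, hls⟩ := ih fun _ hx => hl (List.mem_cons_of_mem m hx)
      by_cases hm : IsEmptyRem m
      · obtain ⟨e, rfl⟩ : ∃ e, m = .rem (Sum.inr e) := by
          rcases m with x | x | e
          · exact hm.elim
          · exact hm.elim
          · exact ⟨e, rfl⟩
        obtain ⟨s', hs', hes, hss⟩ :=
          hs.exists_insert hp pinv pprec (hl List.mem_cons_self)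
        refine ⟨s', hs', fun n hn hne => ?_⟩
        rcases List.mem_cons.mp hn with rfl | hn
        · exact hes
        · exact hss (hls n hn hne)
      · refine ⟨s, hs, fun n hn hne => ?_⟩
        rcases List.mem_cons.mp hn with rfl | hn
        · exact absurd hne hm
        · exact hls n hn hne
  obtain ⟨s, hs, hps⟩ := hall p (List.Subset.refl p)
  refine linearizable_intro hh hs.mem_stackSpec hs.mem_stackSpec.1.1 hs.invoked
    (fun m k hk => ?_) hs.precedes
  by_cases hm : IsEmptyRem m
  · exact hps m (pres m k hk) hm
  · exact hs.completed m k hk hm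

end LL
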